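/- Let p, q ≥ 1, n = p+q, and let λ, μ be weakly decreasing real n-sequences. Then for every matrix ξ ∈ M_n(ℂ), the set { (X, Y) : X ∈ O^{nc}_λ, Y ∈ O^{nc}_μ, X + Y = ξ } is a compact subset of M_n(ℂ) × M_n(ℂ); in particular the addition map O^{nc}_λ × O^{nc}_μ → M_n(ℂ), (X,Y) ↦ X+Y, is proper. -/

import Mathlib

open Matrix

noncomputable section

/-- The standard flag subspace `span(e_1, …, e_j)` of `ℂ^n` (with 0-indexed coordinates,
this is the space of vectors vanishing on all coordinates `≥ j`). -/
def stdFlag (n j : ℕ) : Submodule ℂ (Fin n → ℂ) where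
  carrier := {f | ∀ i : Fin n, j ≤ (i : ℕ) → f i = 0}
  add_mem' := by
    intro a b ha hb i hi
    simp only [Pi.add_apply, ha i hi, hb i hi, add_zero]
  zero_mem' := by intro i _; rfl
  smul_mem' := by
    intro c f hf i hi
    simp only [Pi.smul_apply, hf i hi, smul_zero]

/-- A quiver given by source and target maps has no oriented cycles. -/
def NoCycles {V A : Type} (src tgt : A → V) : Prop :=
  ∀ (k : ℕ) (f : Fin (k + 1) → A),
    (∀ i : Fin k, tgt (f i.castSucc) = src (f i.succ)) →
    tgt (f (Fin.last k)) ≠ src (f 0)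

/-- `α ≤_Q n` : every representation of the quiver on the spaces `ℂ^{n_x}` has a
subrepresentation of dimension vector `α`. -/
def HasSubrepOfDim {V A : Type} (src tgt : A → V) (n : V → ℕ) (α : V → ℕ) : Prop :=
  ∀ r : ∀ a : A, (Fin (n (src a)) → ℂ) →ₗ[ℂ] (Fin (n (tgt a)) → ℂ),
    ∃ S : ∀ x : V, Submodule ℂ (Fin (n x) → ℂ),
      (∀ x : V, Module.finrank ℂ (S x) = α x) ∧
      (∀ a : A, (S (src a)).map (r a) ≤ S (tgt a))

/-- A family `K = (K_x)` of subsets `K_x ⊆ {1,…,n_x}` is `Q`-intersecting for `n` if every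
representation of the quiver on the `ℂ^{n_x}` admits a subrepresentation `S` lying in the
Schubert variety indexed by `K` (w.r.t. the standard flags). -/
def IsQIntersecting {V A : Type} (src tgt : A → V) (n : V → ℕ)
    (K : ∀ x : V, Finset (Fin (n x))) : Prop :=
  ∀ r : ∀ a : A, (Fin (n (src a)) → ℂ) →ₗ[ℂ] (Fin (n (tgt a)) → ℂ),
    ∃ S : ∀ x : V, Submodule ℂ (Fin (n x) → ℂ),
      (∀ x : V, Module.finrank ℂ (S x) = (K x).card) ∧
      (∀ x : V, ∀ j : Fin (K x).card,
        (j : ℕ) + 1 ≤ Module.finrank ℂ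
          ((S x ⊓ stdFlag (n x) ((((K x).orderIsoOfFin rfl j : Fin (n x)) : ℕ) + 1) :
            Submodule ℂ (Fin (n x) → ℂ)))) ∧
      (∀ a : A, (S (src a)).map (r a) ≤ S (tgt a))

/-- The expected dimension `edim_{Q,B}(K, n)`. -/
def edimQB {V A : Type} [Fintype V] [Fintype A] (src tgt : A → V) (n : V → ℕ)
    (K : ∀ x : V, Finset (Fin (n x))) : ℤ :=
  (∑ x : V, ∑ j : Fin (K x).card,
      (((((K x).orderIsoOfFin rfl j : Fin (n x)) : ℕ) : ℤ) - ((j : ℕ) : ℤ))) -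
  ∑ a : A, ((K (src a)).card : ℤ) * ((n (tgt a) : ℤ) - ((K (tgt a)).card : ℤ))

/-- Composition `K ∘ L` of a family of subsets with a family of subsets of the index sets. -/
def composeFam {V : Type} {n : V → ℕ} (K : ∀ x : V, Finset (Fin (n x)))
    (L : ∀ x : V, Finset (Fin (K x).card)) : ∀ x : V, Finset (Fin (n x)) :=
  fun x => (L x).image (fun j => ((K x).orderIsoOfFin rfl j : Fin (n x)))

/-- The moment map for the action of `∏_x U(n_x)` on the representation space of the quiver,
`μ_x(r) = Σ_{b : y→x} r_b r_b^* − Σ_{a : x→y} r_a^* r_a`. -/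
def momentMap {V A : Type} [Fintype A] [DecidableEq V] (src tgt : A → V) (n : V → ℕ)
    (r : ∀ a : A, Matrix (Fin (n (tgt a))) (Fin (n (src a))) ℂ) (x : V) :
    Matrix (Fin (n x)) (Fin (n x)) ℂ :=
  (∑ a : A, if h : tgt a = x then
      Matrix.reindex (finCongr (congrArg n h)) (finCongr (congrArg n h)) (r a * (r a)ᴴ)
    else 0) -
  (∑ a : A, if h : src a = x then
      Matrix.reindex (finCongr (congrArg n h)) (finCongr (congrArg n h)) ((r a)ᴴ * r a)
    else 0)

/-! ### The quiver `Q_{3,3}` with vertices `1,…,6` and arrows `1→3, 2→3, 4→3, 4→5, 4→6`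
(0-indexed: `0→2, 1→2, 3→2, 3→4, 3→5`). -/

def q33src : Fin 5 → Fin 6 := ![0, 1, 3, 3, 3]

def q33tgt : Fin 5 → Fin 6 := ![2, 2, 2, 4, 5]

/-- The dimension vector `[p,p,p,q,q,q]` for `Q_{3,3}`. -/
def n33 (p q : ℕ) : Fin 6 → ℕ
  | ⟨0, _⟩ => p
  | ⟨1, _⟩ => p
  | ⟨2, _⟩ => p
  | ⟨3, _⟩ => q
  | ⟨4, _⟩ => q
  | ⟨5, _⟩ => q

/-- A family of subsets for `Q_{3,3}` built from three subsets of `{1,…,p}` (vertices 1,2,3)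
and three subsets of `{1,…,q}` (vertices 4,5,6). -/
def fam6 (p q : ℕ) (K : Fin 3 → Finset (Fin p)) (L : Fin 3 → Finset (Fin q)) :
    ∀ x : Fin 6, Finset (Fin (n33 p q x))
  | ⟨0, _⟩ => K 0
  | ⟨1, _⟩ => K 1
  | ⟨2, _⟩ => K 2
  | ⟨3, _⟩ => L 0
  | ⟨4, _⟩ => L 1
  | ⟨5, _⟩ => L 2

/-! ### The pseudo-unitary group `U(p,q)` -/

/-- The matrix `η = diag(I_p, −I_q)`. -/
def etaMat (p q : ℕ) : Matrix (Fin (p + q)) (Fin (p + q)) ℂ :=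
  Matrix.diagonal fun i => if (i : ℕ) < p then 1 else -1

/-- Membership in `U(p,q) = {g : gᴴ η g = η}`. -/
def InUpq (p q : ℕ) (g : Matrix (Fin (p + q)) (Fin (p + q)) ℂ) : Prop :=
  gᴴ * etaMat p q * g = etaMat p q

/-- The central element `Z = diag(q I_p, −p I_q)`. -/
def Zmat (p q : ℕ) : Matrix (Fin (p + q)) (Fin (p + q)) ℂ :=
  Matrix.diagonal fun i => if (i : ℕ) < p then (q : ℂ) else -(p : ℂ)

/-- The complex diagonal matrix with entries a real sequence. -/
def Dmat {n : ℕ} (A : Fin n → ℝ) : Matrix (Fin n) (Fin n) ℂ :=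
  Matrix.diagonal fun i => (A i : ℂ)

/-- The block-diagonal matrix `u ⊕ v`. -/
def blockDiag {p q : ℕ} (u : Matrix (Fin p) (Fin p) ℂ) (v : Matrix (Fin q) (Fin q) ℂ) :
    Matrix (Fin (p + q)) (Fin (p + q)) ℂ :=
  Matrix.reindex finSumFinEquiv finSumFinEquiv (Matrix.fromBlocks u 0 0 v)

end

section PseudoHermitian

variable {ι : Type*} [Fintype ι]

/-- The sesquilinear form `∑ₖ s k * conj (x k) * y k`, linear in its second argument. -/
def signForm (s : ι → ℝ) (x : ι → ℂ) : (ι → ℂ) →ₗ[ℂ] ℂ :=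
  ∑ k, ((s k : ℂ) * star (x k)) • LinearMap.proj k

theorem signForm_apply (s : ι → ℝ) (x y : ι → ℂ) :
    signForm s x y = ∑ k, (s k : ℂ) * star (x k) * y k := by
  simp [signForm]

theorem star_signForm (s : ι → ℝ) (x y : ι → ℂ) :
    star (signForm s x y) = signForm s y x := by
  simp only [signForm_apply, star_sum, star_mul', star_star]
  refine Finset.sum_congr rfl fun k _ => ?_
  simp
  ring

theorem signForm_self_smul (s : ι → ℝ) (r : ℝ) (x : ι → ℂ) :
    signForm s ((r : ℂ) • x) ((r : ℂ) • x) = (r * r : ℝ) * signForm s x x := by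
  simp only [signForm_apply, Finset.mul_sum]
  refine Finset.sum_congr rfl fun k _ => ?_
  simp
  ring

/-- A family of vectors indexed by `S` whose Gram matrix for `signForm s` is `diag (s i)`. -/
def IsSignOrthonormal [DecidableEq ι] (s : ι → ℝ) (S : Finset ι) (v : ι → ι → ℂ) : Prop :=
  ∀ i ∈ S, ∀ k ∈ S, signForm s (v i) (v k) = if i = k then (s i : ℂ) else 0

variable [DecidableEq ι]

theorem exists_ne_zero_signForm_eq_zero (s : ι → ℝ) (v : ι → ι → ℂ) (S : Finset ι) (j : ι)
    (hj : j ∉ S) :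
    ∃ x : ι → ℂ, x ≠ 0 ∧ (∀ k, s k ≠ s j → x k = 0) ∧
      ∀ i ∈ S, s i = s j → signForm s (v i) x = 0 := by
  let M : Matrix ι ι ℂ := fun i k =>
    if s i ≠ s j then (if i = k then 1 else 0)
    else if i ∈ S then (s k : ℂ) * star (v i k) else 0
  have hdet : M.det = 0 := by
    refine Matrix.det_eq_zero_of_row_eq_zero j fun k => ?_
    simp [M, hj]
  obtain ⟨x, hx0, hx⟩ := Matrix.exists_mulVec_eq_zero_iff.mpr hdet
  refine ⟨x, hx0, fun k hk => ?_, fun i hi hs => ?_⟩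
  · simpa [M, Matrix.mulVec, dotProduct, hk] using congrFun hx k
  · simpa [M, Matrix.mulVec, dotProduct, hi, hs, signForm_apply] using congrFun hx i

theorem IsSignOrthonormal.exists_signForm_eq {s : ι → ℝ} (hs : ∀ i, s i = 1 ∨ s i = -1)
    {v : ι → ι → ℂ} {S : Finset ι} (hv : IsSignOrthonormal s S v) {j : ι} (hj : j ∉ S) :
    ∃ y : ι → ℂ, signForm s y y = s j ∧ ∀ i ∈ S, signForm s (v i) y = 0 := by
  have hss : ∀ i, s i * s i = 1 := fun i => by rcases hs i with h | h <;> simp [h]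
  obtain ⟨x, hx0, hxs, hxv⟩ := exists_ne_zero_signForm_eq_zero s v S j hj
  have hxx : signForm s x x = ((s j * ∑ k, ‖x k‖ ^ 2 : ℝ) : ℂ) := by
    rw [signForm_apply, Finset.mul_sum, Complex.ofReal_sum]
    refine Finset.sum_congr rfl fun k _ => ?_
    by_cases hk : s k = s j
    · rw [hk, mul_assoc, Complex.star_def, Complex.conj_mul']
      push_cast
      ring
    · simp [hxs k hk]
  have hpos : 0 < ∑ k, ‖x k‖ ^ 2 := by
    obtain ⟨k, hk⟩ := Function.ne_iff.mp hx0
    exact Finset.sum_pos' (fun _ _ => by positivity)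
      ⟨k, Finset.mem_univ k, by have := norm_pos_iff.mpr hk; positivity⟩
  let z : ι → ℂ := x - ∑ i ∈ S, ((s i : ℂ) * signForm s (v i) x) • v i
  have hvz : ∀ i ∈ S, signForm s (v i) z = 0 := by
    intro i hi
    have : ∑ k ∈ S, (s k : ℂ) * signForm s (v k) x * signForm s (v i) (v k)
        = signForm s (v i) x := by
      rw [Finset.sum_eq_single_of_mem i hi]
      · rw [hv i hi i hi, if_pos rfl]
        have : (s i : ℂ) * s i = 1 := by exact_mod_cast hss i
        linear_combination signForm s (v i) x * this
      · intro k hk hki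
        rw [hv i hi k hk, if_neg hki.symm, mul_zero]
    simp only [z, map_sub, map_sum, map_smul, smul_eq_mul, this, sub_self]
  have hzv : ∀ i ∈ S, signForm s z (v i) = 0 := fun i hi => by
    rw [← star_signForm, hvz i hi, star_zero]
  have hzz : signForm s z z
      = ((s j * (∑ k, ‖x k‖ ^ 2 - ∑ i ∈ S, s j * s i * ‖signForm s (v i) x‖ ^ 2) : ℝ) : ℂ) := by
    have h1 : signForm s z z = signForm s z x := by
      conv_lhs => rw [show signForm s z z = signForm s z
        (x - ∑ i ∈ S, ((s i : ℂ) * signForm s (v i) x) • v i) from rfl]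
      simp only [map_sub, map_sum, map_smul, smul_eq_mul]
      rw [Finset.sum_eq_zero fun i hi => by rw [hzv i hi, mul_zero], sub_zero]
    have h2 : signForm s x z = ((s j * ∑ k, ‖x k‖ ^ 2 -
        ∑ i ∈ S, s i * ‖signForm s (v i) x‖ ^ 2 : ℝ) : ℂ) := by
      simp only [z, map_sub, map_sum, map_smul, smul_eq_mul, hxx, Complex.ofReal_sub,
        Complex.ofReal_sum]
      congr 1
      refine Finset.sum_congr rfl fun i _ => ?_
      rw [← star_signForm s (v i) x, mul_assoc, Complex.star_def, Complex.mul_conj']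
      push_cast
      ring
    have h3 : s j * ∑ i ∈ S, s j * s i * ‖signForm s (v i) x‖ ^ 2 =
        ∑ i ∈ S, s i * ‖signForm s (v i) x‖ ^ 2 := by
      rw [Finset.mul_sum]
      refine Finset.sum_congr rfl fun i _ => ?_
      linear_combination (s i * ‖signForm s (v i) x‖ ^ 2) * hss j
    rw [h1, ← star_signForm, h2, Complex.star_def, Complex.conj_ofReal, mul_sub, h3]
  have hle : ∑ i ∈ S, s j * s i * ‖signForm s (v i) x‖ ^ 2 ≤ 0 := by
    refine Finset.sum_nonpos fun i hi => ?_
    by_cases hij : s i = s j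
    · simp [hxv i hi hij]
    · have : s j * s i = -1 := by
        rcases hs i with h | h <;> rcases hs j with h' | h' <;> simp_all
      rw [this]
      nlinarith [sq_nonneg ‖signForm s (v i) x‖]
  set t := ∑ k, ‖x k‖ ^ 2 - ∑ i ∈ S, s j * s i * ‖signForm s (v i) x‖ ^ 2
  have ht : 0 < t := by linarith
  refine ⟨(((√t)⁻¹ : ℝ) : ℂ) • z, ?_, fun i hi => by rw [map_smul, hvz i hi, smul_zero]⟩
  rw [signForm_self_smul, hzz, ← mul_inv, Real.mul_self_sqrt ht.le, ← Complex.ofReal_mul]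
  congr 1
  field_simp

theorem IsSignOrthonormal.exists_extend {s : ι → ℝ} (hs : ∀ i, s i = 1 ∨ s i = -1)
    {v : ι → ι → ℂ} {S : Finset ι} (hv : IsSignOrthonormal s S v) :
    ∃ w : ι → ι → ℂ, IsSignOrthonormal s Finset.univ w ∧ ∀ i ∈ S, w i = v i := by
  suffices h : ∀ T : Finset ι, ∃ w : ι → ι → ℂ, IsSignOrthonormal s (T ∪ S) w ∧
      ∀ i ∈ S, w i = v i by
    simpa only [Finset.union_eq_left.mpr (Finset.subset_univ S)] using h Finset.univ
  intro T
  induction T using Finset.induction_on with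
  | empty => exact ⟨v, by simpa using hv, fun _ _ => rfl⟩
  | insert j T _ ih =>
    obtain ⟨w, hw, hwv⟩ := ih
    rw [Finset.insert_union]
    by_cases hj : j ∈ T ∪ S
    · exact ⟨w, by rwa [Finset.insert_eq_of_mem hj], hwv⟩
    obtain ⟨y, hyy, hy⟩ := hw.exists_signForm_eq hs hj
    refine ⟨Function.update w j y, fun i hi k hk => ?_, fun i hi => ?_⟩
    · have hne : ∀ l ∈ T ∪ S, l ≠ j := fun l hl h => hj (h ▸ hl)
      rcases Finset.mem_insert.mp hi with hij | hi <;>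
        rcases Finset.mem_insert.mp hk with hkj | hk
      · simp [hij, hkj, hyy]
      · simp [hij, hne k hk, (hne k hk).symm, ← star_signForm s (w k) y, hy k hk]
      · simp [hkj, hne i hi, hy i hi]
      · simp [hne i hi, hne k hk, hw i hi k hk]
    · rw [Function.update_of_ne, hwv i hi]
      rintro rfl
      exact hj (Finset.mem_union_right _ hi)

end PseudoHermitian

/-- The diagonal signs of `η`. -/
def etaSign (p q : ℕ) (i : Fin (p + q)) : ℝ := if (i : ℕ) < p then 1 else -1

theorem etaSign_eq_or (p q : ℕ) (i : Fin (p + q)) : etaSign p q i = 1 ∨ etaSign p q i = -1 := by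
  unfold etaSign
  split_ifs <;> simp

theorem etaMat_eq (p q : ℕ) : etaMat p q = diagonal fun i => (etaSign p q i : ℂ) := by
  unfold etaMat etaSign
  congr 1
  ext i
  split_ifs <;> simp

theorem etaMat_mul_self (p q : ℕ) : etaMat p q * etaMat p q = 1 := by
  rw [etaMat_eq, diagonal_mul_diagonal, ← diagonal_one]
  congr 1
  ext i
  rcases etaSign_eq_or p q i with h | h <;> simp [h]

theorem conjTranspose_mul_etaMat_mul_apply {p q : ℕ} (g : Matrix (Fin (p + q)) (Fin (p + q)) ℂ)
    (i k : Fin (p + q)) :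
    (gᴴ * etaMat p q * g) i k = signForm (etaSign p q) (gᵀ i) (gᵀ k) := by
  rw [etaMat_eq, mul_apply, signForm_apply]
  refine Finset.sum_congr rfl fun l _ => ?_
  rw [mul_diagonal, conjTranspose_apply, transpose_apply, transpose_apply]
  ring

theorem inUpq_iff {p q : ℕ} (g : Matrix (Fin (p + q)) (Fin (p + q)) ℂ) :
    InUpq p q g ↔ IsSignOrthonormal (etaSign p q) Finset.univ gᵀ := by
  unfold InUpq IsSignOrthonormal
  rw [← Matrix.ext_iff]
  simp only [conjTranspose_mul_etaMat_mul_apply, Finset.mem_univ, forall_const]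
  simp only [etaMat_eq, diagonal_apply]

theorem InUpq.inv_eq {p q : ℕ} {g : Matrix (Fin (p + q)) (Fin (p + q)) ℂ} (hg : InUpq p q g) :
    g⁻¹ = etaMat p q * gᴴ * etaMat p q := by
  refine inv_eq_left_inv ?_
  rw [Matrix.mul_assoc, Matrix.mul_assoc, ← Matrix.mul_assoc gᴴ, hg, etaMat_mul_self]

/-- The matrix `c + V E Vᴴ η`, for `E` a real diagonal matrix. -/
def orbitParam {p q : ℕ} (c : ℝ) (E : Fin (p + q) → ℝ) (V : Matrix (Fin (p + q)) (Fin (p + q)) ℂ) :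
    Matrix (Fin (p + q)) (Fin (p + q)) ℂ :=
  (c : ℂ) • 1 + V * Dmat E * Vᴴ * etaMat p q

theorem continuous_orbitParam {p q : ℕ} (c : ℝ) (E : Fin (p + q) → ℝ) :
    Continuous (orbitParam c E) := by
  have h : Continuous fun V : Matrix (Fin (p + q)) (Fin (p + q)) ℂ =>
      V * Dmat E * Vᴴ * etaMat p q :=
    ((continuous_id.matrix_mul continuous_const).matrix_mul
      continuous_id.matrix_conjTranspose).matrix_mul continuous_const
  exact continuous_const.add h

theorem mul_Dmat_mul_conjTranspose_apply {n : ℕ} (E : Fin n → ℝ) (V : Matrix (Fin n) (Fin n) ℂ)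
    (a b : Fin n) :
    (V * Dmat E * Vᴴ) a b = ∑ i, V a i * (E i : ℂ) * star (V b i) := by
  rw [mul_apply]
  refine Finset.sum_congr rfl fun i _ => ?_
  rw [Dmat, mul_diagonal, conjTranspose_apply]

theorem mul_Dmat_mul_conjTranspose_congr {n : ℕ} {E : Fin n → ℝ} {V W : Matrix (Fin n) (Fin n) ℂ}
    (h : ∀ i, E i ≠ 0 → Vᵀ i = Wᵀ i) : V * Dmat E * Vᴴ = W * Dmat E * Wᴴ := by
  ext a b
  rw [mul_Dmat_mul_conjTranspose_apply, mul_Dmat_mul_conjTranspose_apply]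
  refine Finset.sum_congr rfl fun i _ => ?_
  by_cases hi : E i = 0
  · simp [hi]
  · have ha := congrFun (h i hi) a
    have hb := congrFun (h i hi) b
    simp only [transpose_apply] at ha hb
    rw [ha, hb]

theorem InUpq.mul_Dmat_mul_inv {p q : ℕ} {g : Matrix (Fin (p + q)) (Fin (p + q)) ℂ}
    (hg : InUpq p q g) (c : ℝ) (A : Fin (p + q) → ℝ) :
    g * Dmat A * g⁻¹ = orbitParam c (fun i => (A i - c) * etaSign p q i) g := by
  have hD : Dmat A = (c : ℂ) • 1 + Dmat (fun i => (A i - c) * etaSign p q i) * etaMat p q := by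
    rw [etaMat_eq, Dmat, Dmat, diagonal_mul_diagonal, ← diagonal_one, ← diagonal_smul,
      diagonal_add]
    congr 1
    ext i
    rcases etaSign_eq_or p q i with h | h <;> simp [h]
  have hgg : g * g⁻¹ = 1 := by
    rw [hg.inv_eq]
    refine mul_eq_one_comm.mp ?_
    rw [Matrix.mul_assoc, Matrix.mul_assoc, ← Matrix.mul_assoc gᴴ, hg, etaMat_mul_self]
  rw [hD, Matrix.mul_add, Matrix.add_mul, Matrix.mul_smul, Matrix.smul_mul, Matrix.mul_one, hgg,
    hg.inv_eq, orbitParam]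
  congr 1
  simp only [Matrix.mul_assoc]
  rw [← Matrix.mul_assoc (etaMat p q) (etaMat p q), etaMat_mul_self, Matrix.one_mul]

/-- The orbit of `A` is parametrised by the columns `v i` with `A i ≠ c` only. -/
theorem exists_inUpq_iff {p q : ℕ} (c : ℝ) (A : Fin (p + q) → ℝ)
    (X : Matrix (Fin (p + q)) (Fin (p + q)) ℂ) :
    (∃ g, InUpq p q g ∧ X = g * Dmat A * g⁻¹) ↔
      ∃ V : Matrix (Fin (p + q)) (Fin (p + q)) ℂ,
        IsSignOrthonormal (etaSign p q)
          {i | (A i - c) * etaSign p q i ≠ 0} Vᵀ ∧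
        (∀ a i, (A i - c) * etaSign p q i = 0 → V a i = 0) ∧
        X = orbitParam c (fun i => (A i - c) * etaSign p q i) V := by
  constructor
  · rintro ⟨g, hg, rfl⟩
    let V : Matrix (Fin (p + q)) (Fin (p + q)) ℂ :=
      of fun a i => if (A i - c) * etaSign p q i = 0 then 0 else g a i
    have hV : ∀ i, (A i - c) * etaSign p q i ≠ 0 → gᵀ i = Vᵀ i := fun i hi => by
      ext a
      simp only [transpose_apply, V, of_apply, if_neg hi]
    refine ⟨V, fun i hi k hk => ?_, fun a i h => if_pos h, ?_⟩
    · rw [← hV i (by simpa using hi), ← hV k (by simpa using hk)]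
      exact (inUpq_iff g).mp hg i (Finset.mem_univ i) k (Finset.mem_univ k)
    · rw [hg.mul_Dmat_mul_inv c, orbitParam, orbitParam, mul_Dmat_mul_conjTranspose_congr hV]
  · rintro ⟨V, hV, -, rfl⟩
    obtain ⟨w, hw, hwV⟩ := hV.exists_extend (etaSign_eq_or p q)
    have hg : InUpq p q (of w)ᵀ := (inUpq_iff _).mpr hw
    refine ⟨_, hg, ?_⟩
    rw [hg.mul_Dmat_mul_inv c, orbitParam, orbitParam]
    congr 2
    exact mul_Dmat_mul_conjTranspose_congr fun i hi => (hwV i (by simpa using hi)).symm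

theorem continuous_signForm_transpose {n : ℕ} (s : Fin n → ℝ) (i k : Fin n) :
    Continuous fun V : Matrix (Fin n) (Fin n) ℂ => signForm s (Vᵀ i) (Vᵀ k) := by
  simp only [signForm_apply, transpose_apply]
  fun_prop

theorem isClosed_isSignOrthonormal_transpose {n : ℕ} (s : Fin n → ℝ) (S : Finset (Fin n)) :
    IsClosed {V : Matrix (Fin n) (Fin n) ℂ | IsSignOrthonormal s S Vᵀ} := by
  simp only [IsSignOrthonormal, Set.ofPred_forall]
  exact isClosed_iInter fun i => isClosed_iInter fun _ => isClosed_iInter fun k =>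
    isClosed_iInter fun _ => isClosed_eq (continuous_signForm_transpose s i k) continuous_const

theorem trace_mul_Dmat_mul_conjTranspose {n : ℕ} (E : Fin n → ℝ) (V : Matrix (Fin n) (Fin n) ℂ) :
    (V * Dmat E * Vᴴ).trace = ((∑ a, ∑ i, E i * ‖V a i‖ ^ 2 : ℝ) : ℂ) := by
  simp only [Matrix.trace, Matrix.diag, mul_Dmat_mul_conjTranspose_apply, Complex.ofReal_sum]
  refine Finset.sum_congr rfl fun a _ => Finset.sum_congr rfl fun i _ => ?_
  rw [mul_right_comm, Complex.star_def, Complex.mul_conj']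
  push_cast
  ring

theorem orbitParam_mul_etaMat {p q : ℕ} (c : ℝ) (E : Fin (p + q) → ℝ)
    (V : Matrix (Fin (p + q)) (Fin (p + q)) ℂ) :
    orbitParam c E V * etaMat p q = (c : ℂ) • etaMat p q + V * Dmat E * Vᴴ := by
  rw [orbitParam, Matrix.add_mul, Matrix.mul_assoc _ (etaMat p q), etaMat_mul_self,
    Matrix.smul_mul, Matrix.one_mul, Matrix.mul_one]

theorem sum_add_sum_eq_re_trace {p q : ℕ} {c d : ℝ} {E F : Fin (p + q) → ℝ}
    {V W xi : Matrix (Fin (p + q)) (Fin (p + q)) ℂ}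
    (h : orbitParam c E V + orbitParam d F W = xi) :
    ∑ a, ∑ i, E i * ‖V a i‖ ^ 2 + ∑ a, ∑ i, F i * ‖W a i‖ ^ 2 =
      ((xi - ((c + d : ℝ) : ℂ) • 1) * etaMat p q).trace.re := by
  have : (xi - ((c + d : ℝ) : ℂ) • 1) * etaMat p q = V * Dmat E * Vᴴ + W * Dmat F * Wᴴ := by
    rw [← h, Matrix.sub_mul, Matrix.add_mul, orbitParam_mul_etaMat, orbitParam_mul_etaMat,
      Matrix.smul_mul, Matrix.one_mul, Complex.ofReal_add, add_smul]
    abel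
  rw [this, trace_add, trace_mul_Dmat_mul_conjTranspose, trace_mul_Dmat_mul_conjTranspose,
    ← Complex.ofReal_add, Complex.ofReal_re]

theorem norm_le_sqrt_div_of_sum_le {n : ℕ} {E : Fin n → ℝ} (hE : ∀ i, 0 ≤ E i)
    {V : Matrix (Fin n) (Fin n) ℂ} (hV : ∀ a i, E i = 0 → V a i = 0) {T : ℝ}
    (h : ∑ a, ∑ i, E i * ‖V a i‖ ^ 2 ≤ T) (a i : Fin n) : ‖V a i‖ ≤ √(T / E i) := by
  rcases (hE i).eq_or_lt with h0 | h0
  · simp [hV a i h0.symm]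
  refine Real.le_sqrt_of_sq_le ?_
  rw [le_div_iff₀ h0, mul_comm]
  have hnn : ∀ b k, 0 ≤ E k * ‖V b k‖ ^ 2 := fun b k => mul_nonneg (hE k) (sq_nonneg _)
  calc E i * ‖V a i‖ ^ 2 ≤ ∑ k, E k * ‖V a k‖ ^ 2 :=
        Finset.single_le_sum (fun k _ => hnn a k) (Finset.mem_univ i)
    _ ≤ ∑ b, ∑ k, E k * ‖V b k‖ ^ 2 :=
        Finset.single_le_sum (f := fun b => ∑ k, E k * ‖V b k‖ ^ 2)
          (fun b _ => Finset.sum_nonneg fun k _ => hnn b k) (Finset.mem_univ a)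
    _ ≤ T := h

theorem isCompact_setOf_norm_le {n : ℕ} (R : Fin n → ℝ) :
    IsCompact {V : Matrix (Fin n) (Fin n) ℂ | ∀ a i, ‖V a i‖ ≤ R i} := by
  have h : IsCompact (Set.univ.pi fun _ : Fin n => Set.univ.pi fun i : Fin n =>
      Metric.closedBall (0 : ℂ) (R i)) :=
    isCompact_univ_pi fun _ => isCompact_univ_pi fun i => isCompact_closedBall 0 (R i)
  have heq : {V : Matrix (Fin n) (Fin n) ℂ | ∀ a i, ‖V a i‖ ≤ R i} =
      (Set.univ.pi fun _ : Fin n => Set.univ.pi fun i : Fin n =>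
        Metric.closedBall (0 : ℂ) (R i)) := by
    ext V
    exact ⟨fun h a _ i _ => mem_closedBall_zero_iff.mpr (h a i),
      fun h a i => mem_closedBall_zero_iff.mp (h a trivial i trivial)⟩
  rw [heq]
  exact h

theorem sub_mul_etaSign_nonneg {p q : ℕ} (hp : 1 ≤ p) {A : Fin (p + q) → ℝ} (hA : Antitone A)
    (i : Fin (p + q)) : 0 ≤ (A i - A ⟨p - 1, by omega⟩) * etaSign p q i := by
  unfold etaSign
  split_ifs with h
  · have : A ⟨p - 1, by omega⟩ ≤ A i := hA (Fin.mk_le_mk.mpr (by omega) : i ≤ ⟨p - 1, _⟩)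
    linarith
  · have : A i ≤ A ⟨p - 1, by omega⟩ := hA (Fin.mk_le_mk.mpr (by omega) : ⟨p - 1, _⟩ ≤ i)
    linarith

/-- For any matrix `ξ`, the fiber of the addition map
`O^{nc}_λ × O^{nc}_μ → M_n(ℂ)` over `ξ` is compact (so the addition map is proper). -/
theorem addition_fiber_compact (p q : ℕ) (hp : 1 ≤ p) (hq : 1 ≤ q)
    (lam mu : Fin (p + q) → ℝ) (hlam : Antitone lam) (hmu : Antitone mu)
    (xi : Matrix (Fin (p + q)) (Fin (p + q)) ℂ) :
    IsCompact {P : Matrix (Fin (p + q)) (Fin (p + q)) ℂ ×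
        Matrix (Fin (p + q)) (Fin (p + q)) ℂ |
      (∃ g : Matrix (Fin (p + q)) (Fin (p + q)) ℂ, InUpq p q g ∧
        P.1 = g * Dmat lam * g⁻¹) ∧
      (∃ h : Matrix (Fin (p + q)) (Fin (p + q)) ℂ, InUpq p q h ∧
        P.2 = h * Dmat mu * h⁻¹) ∧
      P.1 + P.2 = xi} := by
  obtain ⟨c, hc⟩ : ∃ c, ∀ i, 0 ≤ (lam i - c) * etaSign p q i :=
    ⟨_, sub_mul_etaSign_nonneg hp hlam⟩
  obtain ⟨d, hd⟩ : ∃ d, ∀ i, 0 ≤ (mu i - d) * etaSign p q i :=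
    ⟨_, sub_mul_etaSign_nonneg hp hmu⟩
  simp only [exists_inUpq_iff c lam, exists_inUpq_iff d mu]
  set E : Fin (p + q) → ℝ := fun i => (lam i - c) * etaSign p q i
  set F : Fin (p + q) → ℝ := fun i => (mu i - d) * etaSign p q i
  set T : ℝ := ((xi - ((c + d : ℝ) : ℂ) • 1) * etaMat p q).trace.re
  let K : Set (Matrix (Fin (p + q)) (Fin (p + q)) ℂ × Matrix (Fin (p + q)) (Fin (p + q)) ℂ) :=
    {V | ∀ a i, ‖V a i‖ ≤ √(T / E i)} ×ˢ {W | ∀ a i, ‖W a i‖ ≤ √(T / F i)} ∩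
      ({V | IsSignOrthonormal (etaSign p q) {i | E i ≠ 0} Vᵀ} ×ˢ
        {W | IsSignOrthonormal (etaSign p q) {i | F i ≠ 0} Wᵀ} ∩
      {P | orbitParam c E P.1 + orbitParam d F P.2 = xi})
  have hK : IsCompact K := by
    refine ((isCompact_setOf_norm_le _).prod (isCompact_setOf_norm_le _)).inter_right
      (((isClosed_isSignOrthonormal_transpose _ _).prod
        (isClosed_isSignOrthonormal_transpose _ _)).inter (isClosed_eq ?_ continuous_const))
    exact ((continuous_orbitParam c E).comp continuous_fst).add
      ((continuous_orbitParam d F).comp continuous_snd)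
  have himage := hK.image (f := Prod.map (orbitParam c E) (orbitParam d F))
    ((continuous_orbitParam c E).prodMap (continuous_orbitParam d F))
  convert himage using 1
  ext ⟨X, Y⟩
  constructor
  · rintro ⟨⟨V, hV, hV0, rfl⟩, ⟨W, hW, hW0, rfl⟩, h⟩
    have hsum := sum_add_sum_eq_re_trace h
    have hVn : 0 ≤ ∑ a, ∑ i, E i * ‖V a i‖ ^ 2 := Finset.sum_nonneg fun a _ =>
      Finset.sum_nonneg fun i _ => mul_nonneg (hc i) (sq_nonneg _)
    have hWn : 0 ≤ ∑ a, ∑ i, F i * ‖W a i‖ ^ 2 := Finset.sum_nonneg fun a _ =>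
      Finset.sum_nonneg fun i _ => mul_nonneg (hd i) (sq_nonneg _)
    exact ⟨(V, W), ⟨⟨norm_le_sqrt_div_of_sum_le hc hV0 (by linarith),
      norm_le_sqrt_div_of_sum_le hd hW0 (by linarith)⟩, ⟨hV, hW⟩, h⟩, rfl⟩
  · rintro ⟨⟨V, W⟩, ⟨⟨hVn, hWn⟩, ⟨hV, hW⟩, h⟩, heq⟩
    obtain ⟨rfl, rfl⟩ := Prod.mk.inj heq
    refine ⟨⟨V, hV, fun a i hi => ?_, rfl⟩, ⟨W, hW, fun a i hi => ?_, rfl⟩, h⟩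
    · have := hVn a i
      rw [show E i = 0 from hi] at this
      simpa using this
    · have := hWn a i
      rw [show F i = 0 from hi] at this
      simpa using this
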